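/- arXiv:1402.2467 — 5 statements merged into one kernel-verified Lean document; each statement's English description precedes it below -/
import Mathlib

section
/- Let U ⊆ ℝ × ℝ be open and let ν > 0. Let φ, ψ : ℝ × ℝ → ℝ be functions such that at every point of U the partial derivatives ∂ₜφ, ∂ₓφ, ∂ₓ²φ, ∂ₜψ, ∂ₓψ, ∂ₓ²ψ exist, φ > 0 on U, ∂ₜφ + ν·∂ₓ²φ = 0 on U, and ∂ₜψ − ν·∂ₓ²ψ = 0 on U. Define u := 2ν·log φ and m := φ·ψ. Then at every point of U the function x ↦ m·∂ₓu is differentiable in the space variable and m satisfies the Fokker–Planck equation ∂ₜm − ν·∂ₓ²m + ∂ₓ(m·∂ₓu) = 0. -/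
open Real Set MeasureTheory intervalIntegral

/-- Partial derivative in the first (space) variable. -/
noncomputable def pdx (f : ℝ × ℝ → ℝ) (p : ℝ × ℝ) : ℝ :=
  deriv (fun x => f (x, p.2)) p.1

/-- Partial derivative in the second (time) variable. -/
noncomputable def pdt (f : ℝ × ℝ → ℝ) (p : ℝ × ℝ) : ℝ :=
  deriv (fun t => f (p.1, t)) p.2

/-- Second partial derivative in the first (space) variable. -/
noncomputable def pdxx (f : ℝ × ℝ → ℝ) (p : ℝ × ℝ) : ℝ :=
  deriv (fun x => pdx f (x, p.2)) p.1

/-- the change of variables `(u, m) = (2ν log φ, φψ)` turns a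
forward heat equation for `ψ` (with `φ` solving the backward heat equation)
into the Fokker–Planck equation for `m`. -/
theorem stmt_1 (U : Set (ℝ × ℝ)) (hU : IsOpen U) (ν : ℝ) (hν : 0 < ν)
    (φ ψ u m : ℝ × ℝ → ℝ)
    (hu : u = fun p => 2 * ν * Real.log (φ p))
    (hm : m = fun p => φ p * ψ p)
    (hφpos : ∀ p ∈ U, 0 < φ p)
    (hφx : ∀ p ∈ U, DifferentiableAt ℝ (fun x => φ (x, p.2)) p.1)
    (hφt : ∀ p ∈ U, DifferentiableAt ℝ (fun t => φ (p.1, t)) p.2)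
    (hφxx : ∀ p ∈ U, DifferentiableAt ℝ (fun x => pdx φ (x, p.2)) p.1)
    (hψx : ∀ p ∈ U, DifferentiableAt ℝ (fun x => ψ (x, p.2)) p.1)
    (hψt : ∀ p ∈ U, DifferentiableAt ℝ (fun t => ψ (p.1, t)) p.2)
    (hψxx : ∀ p ∈ U, DifferentiableAt ℝ (fun x => pdx ψ (x, p.2)) p.1)
    (hφheat : ∀ p ∈ U, pdt φ p + ν * pdxx φ p = 0)
    (hψheat : ∀ p ∈ U, pdt ψ p - ν * pdxx ψ p = 0) :
    ∀ p ∈ U,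
      DifferentiableAt ℝ (fun x => m (x, p.2) * pdx u (x, p.2)) p.1 ∧
      pdt m p - ν * pdxx m p + pdx (fun q => m q * pdx u q) p = 0 := by
  rintro ⟨x₀, t₀⟩ hp
  have hev : ∀ᶠ x in nhds x₀, (x, t₀) ∈ U := by
    have hc : Continuous (fun x : ℝ => (x, t₀)) := by fun_prop
    exact hc.continuousAt.eventually (hU.mem_nhds hp)
  have dφ : ∀ x, (x, t₀) ∈ U → HasDerivAt (fun x => φ (x, t₀)) (pdx φ (x, t₀)) x :=
    fun x hx => (hφx _ hx).hasDerivAt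
  have dψ : ∀ x, (x, t₀) ∈ U → HasDerivAt (fun x => ψ (x, t₀)) (pdx ψ (x, t₀)) x :=
    fun x hx => (hψx _ hx).hasDerivAt
  have dφ2 : HasDerivAt (fun x => pdx φ (x, t₀)) (pdxx φ (x₀, t₀)) x₀ :=
    (hφxx _ hp).hasDerivAt
  have dψ2 : HasDerivAt (fun x => pdx ψ (x, t₀)) (pdxx ψ (x₀, t₀)) x₀ :=
    (hψxx _ hp).hasDerivAt
  have dφt : HasDerivAt (fun t => φ (x₀, t)) (pdt φ (x₀, t₀)) t₀ :=
    (hφt _ hp).hasDerivAt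
  have dψt : HasDerivAt (fun t => ψ (x₀, t)) (pdt ψ (x₀, t₀)) t₀ :=
    (hψt _ hp).hasDerivAt
  -- near `x₀`, `m * ∂ₓ u = 2 ν ψ ∂ₓ φ`
  have hflux : (fun x => m (x, t₀) * pdx u (x, t₀)) =ᶠ[nhds x₀]
      fun x => 2 * ν * (ψ (x, t₀) * pdx φ (x, t₀)) := by
    filter_upwards [hev] with x hx
    have hpos := (hφpos _ hx).ne'
    have h1 : pdx u (x, t₀) = 2 * ν * (pdx φ (x, t₀) / φ (x, t₀)) := by
      rw [hu]
      exact (((dφ x hx).log hpos).const_mul (2 * ν)).deriv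
    rw [h1, hm]
    field_simp
  have dflux := ((((dψ x₀ hp).mul dφ2).const_mul (2 * ν))).congr_of_eventuallyEq hflux
  have hmx : (fun x => pdx m (x, t₀)) =ᶠ[nhds x₀]
      fun x => pdx φ (x, t₀) * ψ (x, t₀) + φ (x, t₀) * pdx ψ (x, t₀) := by
    filter_upwards [hev] with x hx
    rw [hm]
    exact ((dφ x hx).mul (dψ x hx)).deriv
  have dmx := ((dφ2.mul (dψ x₀ hp)).add ((dφ x₀ hp).mul dψ2)).congr_of_eventuallyEq hmx
  have emt : pdt m (x₀, t₀) = pdt φ (x₀, t₀) * ψ (x₀, t₀) + φ (x₀, t₀) * pdt ψ (x₀, t₀) := by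
    rw [hm]
    exact (dφt.mul dψt).deriv
  refine ⟨dflux.differentiableAt, ?_⟩
  have e1 : pdxx m (x₀, t₀) = _ := dmx.deriv
  have e2 : pdx (fun q => m q * pdx u q) (x₀, t₀) = _ := dflux.deriv
  rw [e1, e2, emt]
  have a := hφheat _ hp
  have b := hψheat _ hp
  linear_combination ψ (x₀, t₀) * a + φ (x₀, t₀) * b
end

section
/- Let U ⊆ ℝ × ℝ be open, let ν > 0, and let F : ℝ × ℝ → ℝ. Let φ, ψ : ℝ × ℝ → ℝ be functions such that at every point of U the partial derivatives ∂ₜφ, ∂ₓφ, ∂ₓ²φ, ∂ₜψ, ∂ₓψ, ∂ₓ²ψ exist, φ > 0 on U, and the coupled equations ∂ₜφ + ν·∂ₓ²φ + (φ/(2ν))·F = 0 and ∂ₜψ − ν·∂ₓ²ψ − (ψ/(2ν))·F = 0 hold on U. Define u := 2ν·log φ and m := φ·ψ. Then on U: (i) ∂ₜu + ν·∂ₓ²u + (1/2)·(∂ₓu)² = −F, and (ii) ∂ₜm − ν·∂ₓ²m + ∂ₓ(m·∂ₓu) = 0. -/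
open Real Set MeasureTheory intervalIntegral

/-- the change of variables `(u, m) = (2ν log φ, φψ)` linearizes
the Mean Field Games system with a potential term `F`. -/
theorem stmt_4 (U : Set (ℝ × ℝ)) (hU : IsOpen U) (ν : ℝ) (hν : 0 < ν)
    (F φ ψ u m : ℝ × ℝ → ℝ)
    (hu : u = fun p => 2 * ν * Real.log (φ p))
    (hm : m = fun p => φ p * ψ p)
    (hφpos : ∀ p ∈ U, 0 < φ p)
    (hφx : ∀ p ∈ U, DifferentiableAt ℝ (fun x => φ (x, p.2)) p.1)
    (hφt : ∀ p ∈ U, DifferentiableAt ℝ (fun t => φ (p.1, t)) p.2)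
    (hφxx : ∀ p ∈ U, DifferentiableAt ℝ (fun x => pdx φ (x, p.2)) p.1)
    (hψx : ∀ p ∈ U, DifferentiableAt ℝ (fun x => ψ (x, p.2)) p.1)
    (hψt : ∀ p ∈ U, DifferentiableAt ℝ (fun t => ψ (p.1, t)) p.2)
    (hψxx : ∀ p ∈ U, DifferentiableAt ℝ (fun x => pdx ψ (x, p.2)) p.1)
    (hφeq : ∀ p ∈ U, pdt φ p + ν * pdxx φ p + (φ p / (2 * ν)) * F p = 0)
    (hψeq : ∀ p ∈ U, pdt ψ p - ν * pdxx ψ p - (ψ p / (2 * ν)) * F p = 0) :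
    ∀ p ∈ U,
      pdt u p + ν * pdxx u p + (1 / 2) * (pdx u p) ^ 2 = -F p ∧
      pdt m p - ν * pdxx m p + pdx (fun q => m q * pdx u q) p = 0 := by
  intro p hp
  have hev : ∀ᶠ x in nhds p.1, (x, p.2) ∈ U := by
    have hc : ContinuousAt (fun x : ℝ => (x, p.2)) p.1 := by fun_prop
    exact hc.preimage_mem_nhds (hU.mem_nhds hp)
  have hX : ∀ f : ℝ × ℝ → ℝ,
      (∀ q ∈ U, DifferentiableAt ℝ (fun x => f (x, q.2)) q.1) →
      ∀ q ∈ U, HasDerivAt (fun x => f (x, q.2)) (pdx f q) q.1 :=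
    fun f hf q hq => (hf q hq).hasDerivAt
  have hux : ∀ q ∈ U, pdx u q = 2 * ν * (pdx φ q / φ q) := by
    intro q hq
    subst hu
    exact (((hX φ hφx q hq).log (hφpos q hq).ne').const_mul (2 * ν)).deriv
  have hmx : ∀ q ∈ U, pdx m q = pdx φ q * ψ q + φ q * pdx ψ q := by
    intro q hq
    subst hm
    exact ((hX φ hφx q hq).mul (hX ψ hψx q hq)).deriv
  have a1 := hX φ hφx p hp
  have b1 := hX ψ hψx p hp
  have a2 : HasDerivAt (fun x => pdx φ (x, p.2)) (pdxx φ p) p.1 := (hφxx p hp).hasDerivAt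
  have b2 : HasDerivAt (fun x => pdx ψ (x, p.2)) (pdxx ψ p) p.1 := (hψxx p hp).hasDerivAt
  have at1 : HasDerivAt (fun t => φ (p.1, t)) (pdt φ p) p.2 := (hφt p hp).hasDerivAt
  have bt1 : HasDerivAt (fun t => ψ (p.1, t)) (pdt ψ p) p.2 := (hψt p hp).hasDerivAt
  have hne : φ p ≠ 0 := (hφpos p hp).ne'
  have hut : pdt u p = 2 * ν * (pdt φ p / φ p) := by
    subst hu
    exact ((at1.log hne).const_mul (2 * ν)).deriv
  have hmt : pdt m p = pdt φ p * ψ p + φ p * pdt ψ p := by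
    subst hm
    exact (at1.mul bt1).deriv
  have huxx : pdxx u p = 2 * ν * ((pdxx φ p * φ p - pdx φ p * pdx φ p) / φ p ^ 2) := by
    have h := ((a2.div a1 hne).const_mul (2 * ν)).deriv
    refine Eq.trans (Filter.EventuallyEq.deriv_eq ?_) h
    filter_upwards [hev] with x hx
    exact hux _ hx
  have hmxx : pdxx m p = (pdxx φ p * ψ p + pdx φ p * pdx ψ p)
      + (pdx φ p * pdx ψ p + φ p * pdxx ψ p) := by
    have h := ((a2.mul b1).add (a1.mul b2)).deriv
    refine Eq.trans (Filter.EventuallyEq.deriv_eq ?_) h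
    filter_upwards [hev] with x hx
    exact hmx _ hx
  have hmu : pdx (fun q => m q * pdx u q) p
      = 2 * ν * (pdx ψ p * pdx φ p + ψ p * pdxx φ p) := by
    have h := ((b1.mul a2).const_mul (2 * ν)).deriv
    refine Eq.trans (Filter.EventuallyEq.deriv_eq ?_) h
    filter_upwards [hev] with x hx
    have := (hφpos _ hx).ne'
    simp only [hux _ hx, hm, Pi.mul_apply]
    field_simp
  have e1 : pdt φ p = -(ν * pdxx φ p) - (φ p / (2 * ν)) * F p := by linarith [hφeq p hp]
  have e2 : pdt ψ p = ν * pdxx ψ p + (ψ p / (2 * ν)) * F p := by linarith [hψeq p hp]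
  constructor
  · rw [hut, huxx, hux p hp, e1]
    field_simp
    ring
  · rw [hmt, hmxx, hmu, e1, e2]
    field_simp
    ring
end

section
/- Let ξ₀ > 0, T > 0, a > 0, and let ψ : ℝ × ℝ → ℝ be continuous on [0, ξ₀] × [0, T] such that at every point of (0, ξ₀) × (0, T] the partial derivatives ∂ₜψ and ∂ₓ²ψ exist and ∂ₜψ − ∂ₓ²ψ ≥ 0. Assume ψ(0, t) ≥ 0 and ψ(ξ₀, t) ≥ 0 for all t ∈ [0, T], and ψ(x, 0) ≥ a·sin(π·x/ξ₀) for all x ∈ [0, ξ₀]. Then ψ(x, t) ≥ a·e^{−π²t/ξ₀²}·sin(π·x/ξ₀) for all (x, t) ∈ [0, ξ₀] × [0, T]. -/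
open Real Set MeasureTheory intervalIntegral

open Filter Topology in
theorem aux_left {g : ℝ → ℝ} {d t0 : ℝ} (h0 : 0 < t0) (hg : HasDerivAt g d t0)
    (hm : ∀ t ∈ Set.Icc 0 t0, g t0 ≤ g t) : d ≤ 0 := by
  have h1 := (hasDerivAt_iff_tendsto_slope.1 hg).mono_left
    (nhdsWithin_mono t0 (fun y (hy : y < t0) => ne_of_lt hy) : 𝓝[<] t0 ≤ 𝓝[≠] t0)
  refine le_of_tendsto h1 ?_
  filter_upwards [Ioo_mem_nhdsLT h0] with t ht
  rw [slope_def_field]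
  exact div_nonpos_of_nonneg_of_nonpos (by linarith [hm t ⟨ht.1.le, ht.2.le⟩]) (by linarith [ht.2])

open Filter Topology in
theorem aux_second {f : ℝ → ℝ} {x : ℝ} (hm : IsLocalMin f x) (hc : ContinuousAt f x) :
    0 ≤ deriv (deriv f) x := by
  by_contra! h
  have h2 := isLocalMax_of_deriv_deriv_neg h hm.deriv_eq_zero hc
  have h3 : f =ᶠ[𝓝 x] fun _ => f x := by
    filter_upwards [hm, h2] with y a b using le_antisymm b a
  have h4 := h3.deriv.deriv_eq
  simp at h4
  linarith

/-- comparison of a supersolution of the heat equation with the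
explicit separable solution `a e^{-π² t / ξ₀²} sin (π x / ξ₀)` on the
space–time rectangle `[0, ξ₀] × [0, T]`. -/
theorem stmt_7 (ξ₀ T a : ℝ) (hξ : 0 < ξ₀) (hT : 0 < T) (ha : 0 < a)
    (ψ : ℝ × ℝ → ℝ)
    (hcont : ContinuousOn ψ (Set.Icc 0 ξ₀ ×ˢ Set.Icc 0 T))
    (hψt : ∀ p ∈ Set.Ioo 0 ξ₀ ×ˢ Set.Ioc 0 T, DifferentiableAt ℝ (fun t => ψ (p.1, t)) p.2)
    (hψx : ∀ p ∈ Set.Ioo 0 ξ₀ ×ˢ Set.Ioc 0 T, DifferentiableAt ℝ (fun x => ψ (x, p.2)) p.1)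
    (hψxx : ∀ p ∈ Set.Ioo 0 ξ₀ ×ˢ Set.Ioc 0 T, DifferentiableAt ℝ (fun x => pdx ψ (x, p.2)) p.1)
    (hsuper : ∀ p ∈ Set.Ioo 0 ξ₀ ×ˢ Set.Ioc 0 T, 0 ≤ pdt ψ p - pdxx ψ p)
    (hb0 : ∀ t ∈ Set.Icc 0 T, 0 ≤ ψ (0, t))
    (hbl : ∀ t ∈ Set.Icc 0 T, 0 ≤ ψ (ξ₀, t))
    (hinit : ∀ x ∈ Set.Icc 0 ξ₀, a * Real.sin (π * x / ξ₀) ≤ ψ (x, 0)) :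
    ∀ p ∈ Set.Icc 0 ξ₀ ×ˢ Set.Icc 0 T,
      a * Real.exp (-(π ^ 2) * p.2 / ξ₀ ^ 2) * Real.sin (π * p.1 / ξ₀) ≤ ψ p := by
  by_contra! hcon
  obtain ⟨p, hp, hlt⟩ := hcon
  set v : ℝ × ℝ → ℝ := fun p =>
    a * Real.exp (-(π ^ 2) * p.2 / ξ₀ ^ 2) * Real.sin (π * p.1 / ξ₀) with hv
  have hvc : Continuous v := by rw [hv]; fun_prop
  obtain ⟨ε, hε, hεp⟩ : ∃ ε > 0, ψ p - v p + ε * p.2 < 0 := by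
    have hd : 0 < v p - ψ p := by simp only [hv]; linarith
    have hp2 : 0 ≤ p.2 := hp.2.1
    refine ⟨(v p - ψ p) / (p.2 + 1), by positivity, ?_⟩
    have : (v p - ψ p) / (p.2 + 1) * (p.2 + 1) = v p - ψ p := by field_simp
    have h3 : 0 < (v p - ψ p) / (p.2 + 1) := by positivity
    linarith
  have hWc : ContinuousOn (fun q : ℝ × ℝ => ψ q - v q + ε * q.2)
      (Set.Icc 0 ξ₀ ×ˢ Set.Icc 0 T) :=
    (hcont.sub hvc.continuousOn).add (by fun_prop)
  obtain ⟨⟨x, t⟩, hq, hmin⟩ := (isCompact_Icc.prod isCompact_Icc).exists_isMinOn ⟨p, hp⟩ hWc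
  have hmin' : ∀ q ∈ Set.Icc 0 ξ₀ ×ˢ Set.Icc 0 T,
    ψ (x, t) - v (x, t) + ε * t ≤ ψ q - v q + ε * q.2 := fun q hq => hmin hq
  have hneg := (hmin' p hp).trans_lt hεp
  obtain ⟨⟨hx0, hx1⟩, ⟨ht0, ht1⟩⟩ := hq
  simp only at hx0 hx1 ht0 ht1
  have hεt : 0 ≤ ε * t := by positivity
  have hx0' : 0 < x := by
    rcases hx0.eq_or_lt with h | h
    · subst h
      have := hb0 t ⟨ht0, ht1⟩
      simp [hv] at hneg
      linarith
    · exact h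
  have hx1' : x < ξ₀ := by
    rcases hx1.eq_or_lt with h | h
    · subst h
      have := hbl t ⟨ht0, ht1⟩
      have e : π * x / x = π := by field_simp
      simp [hv, e] at hneg
      linarith
    · exact h
  have ht0' : 0 < t := by
    rcases ht0.eq_or_lt with h | h
    · subst h
      have := hinit x ⟨hx0, hx1⟩
      simp [hv] at hneg
      linarith
    · exact h
  have hmem : ∀ y ∈ Set.Ioo 0 ξ₀, (y, t) ∈ Set.Ioo 0 ξ₀ ×ˢ Set.Ioc 0 T :=
    fun y hy => ⟨hy, ht0', ht1⟩
  have hxI : x ∈ Set.Ioo 0 ξ₀ := ⟨hx0', hx1'⟩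
  have hT1 : HasDerivAt (fun s => ψ (x, s) - v (x, s) + ε * s)
      (pdt ψ (x, t) - (-(π ^ 2) / ξ₀ ^ 2) * v (x, t) + ε) t := by
    have h1 : HasDerivAt (fun s => ψ (x, s)) (pdt ψ (x, t)) t :=
      (hψt _ (hmem x hxI)).hasDerivAt
    have h2 : HasDerivAt (fun s => v (x, s)) ((-(π ^ 2) / ξ₀ ^ 2) * v (x, t)) t := by
      have := (((((hasDerivAt_id t).const_mul (-(π ^ 2))).div_const (ξ₀ ^ 2)).exp).const_mul
        a).mul_const (Real.sin (π * x / ξ₀))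
      refine this.congr_deriv ?_
      simp only [hv, id]
      ring
    have h3 : HasDerivAt (fun s => ε * s) ε t := by
      simpa using (hasDerivAt_id t).const_mul ε
    exact (h1.sub h2).add h3
  have hle := aux_left ht0' hT1
    (fun s hs => hmin' (x, s) ⟨⟨hx0, hx1⟩, hs.1, hs.2.trans ht1⟩)
  have hX1 : ∀ y ∈ Set.Ioo 0 ξ₀, HasDerivAt (fun y => ψ (y, t) - v (y, t) + ε * t)
      (pdx ψ (y, t) - a * Real.exp (-(π ^ 2) * t / ξ₀ ^ 2) *
        (Real.cos (π * y / ξ₀) * (π / ξ₀))) y := by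
    intro y hy
    have h1 : HasDerivAt (fun y => ψ (y, t)) (pdx ψ (y, t)) y :=
      (hψx _ (hmem y hy)).hasDerivAt
    have h2 := ((((hasDerivAt_id y).const_mul π).div_const ξ₀).sin).const_mul
        (a * Real.exp (-(π ^ 2) * t / ξ₀ ^ 2))
    have := (h1.sub h2).add_const (ε * t)
    simpa [hv] using this
  have hX2 : HasDerivAt (fun y => pdx ψ (y, t) - a * Real.exp (-(π ^ 2) * t / ξ₀ ^ 2) *
        (Real.cos (π * y / ξ₀) * (π / ξ₀)))
      (pdxx ψ (x, t) + π ^ 2 / ξ₀ ^ 2 * v (x, t)) x := by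
    have h1 : HasDerivAt (fun y => pdx ψ (y, t)) (pdxx ψ (x, t)) x :=
      (hψxx _ (hmem x hxI)).hasDerivAt
    have h2 := (((((hasDerivAt_id x).const_mul π).div_const ξ₀).cos).mul_const
      (π / ξ₀)).const_mul (a * Real.exp (-(π ^ 2) * t / ξ₀ ^ 2))
    refine (h1.sub h2).congr_deriv ?_
    simp only [hv, id]
    ring
  have hnh : Set.Ioo 0 ξ₀ ∈ nhds x := Ioo_mem_nhds hx0' hx1'
  have hlm : IsLocalMin (fun y => ψ (y, t) - v (y, t) + ε * t) x := by
    filter_upwards [hnh] with y hy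
    exact hmin' (y, t) ⟨⟨hy.1.le, hy.2.le⟩, ht0, ht1⟩
  have hge := aux_second hlm (hX1 x hxI).continuousAt
  have hEq : deriv (fun y => ψ (y, t) - v (y, t) + ε * t) =ᶠ[nhds x]
      (fun y => pdx ψ (y, t) - a * Real.exp (-(π ^ 2) * t / ξ₀ ^ 2) *
        (Real.cos (π * y / ξ₀) * (π / ξ₀))) := by
    filter_upwards [hnh] with y hy using (hX1 y hy).deriv
  rw [hEq.deriv_eq, hX2.deriv] at hge
  have hs := hsuper _ (hmem x hxI)
  rw [neg_div] at hle
  linarith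
end

section
/- Let T > 0, let f₁, f₂ : ℝ → ℝ be integrable on [0, T], and let ε > 0 be such that f₂(t) ≥ ε for almost every t ∈ [0, T]. If 0 ≤ s₁ ≤ s₂ ≤ T and ∫₀^{s₁} f₁(t) dt = ∫₀^{s₂} f₂(t) dt, then ε·(s₂ − s₁) ≤ ∫₀^{T} |f₁(t) − f₂(t)| dt. -/
open Real Set MeasureTheory intervalIntegral

/-- two integrable flows whose cumulative integrals up to times
`s₁ ≤ s₂` coincide, the second being bounded below by `ε`, have hitting times
differing by at most `ε⁻¹` times the `L¹` distance of the flows. -/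
theorem stmt_10 (T : ℝ) (hT : 0 < T) (f₁ f₂ : ℝ → ℝ)
    (hf₁ : IntegrableOn f₁ (Set.Icc 0 T))
    (hf₂ : IntegrableOn f₂ (Set.Icc 0 T))
    (ε : ℝ) (hε : 0 < ε)
    (hlb : ∀ᵐ t ∂(volume.restrict (Set.Icc 0 T)), ε ≤ f₂ t)
    (s₁ s₂ : ℝ) (h0 : 0 ≤ s₁) (h12 : s₁ ≤ s₂) (h2T : s₂ ≤ T)
    (heq : ∫ t in (0:ℝ)..s₁, f₁ t = ∫ t in (0:ℝ)..s₂, f₂ t) :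
    ε * (s₂ - s₁) ≤ ∫ t in (0:ℝ)..T, |f₁ t - f₂ t| := by
  have key : ∀ f : ℝ → ℝ, IntegrableOn f (Set.Icc 0 T) → ∀ a b : ℝ, 0 ≤ a → a ≤ b → b ≤ T →
      IntervalIntegrable f volume a b := by
    intro f hf a b ha hab hb
    rw [intervalIntegrable_iff_integrableOn_Icc_of_le hab]
    exact hf.mono_set (Set.Icc_subset_Icc ha hb)
  have hd : IntegrableOn (fun t => |f₁ t - f₂ t|) (Set.Icc 0 T) := (hf₁.sub hf₂).abs
  have h1T : s₁ ≤ T := h12.trans h2T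
  have h02 : 0 ≤ s₂ := h0.trans h12
  have i1 := key f₁ hf₁ 0 s₁ le_rfl h0 h1T
  have i2 := key f₂ hf₂ 0 s₁ le_rfl h0 h1T
  have i3 := key f₂ hf₂ s₁ s₂ h0 h12 h2T
  have e1 := intervalIntegral.integral_add_adjacent_intervals i2 i3
  have e2 := intervalIntegral.integral_sub i1 i2
  have e3 : ∫ t in (0:ℝ)..s₁, (f₁ t - f₂ t) ≤ ∫ t in (0:ℝ)..s₁, |f₁ t - f₂ t| :=
    intervalIntegral.integral_mono_on h0 (i1.sub i2) (key _ hd 0 s₁ le_rfl h0 h1T)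
      (fun t _ => le_abs_self _)
  have e4 := intervalIntegral.integral_add_adjacent_intervals
    (key _ hd 0 s₁ le_rfl h0 h1T) (key _ hd s₁ T h0 h1T le_rfl)
  have e5 : 0 ≤ ∫ t in s₁..T, |f₁ t - f₂ t| :=
    intervalIntegral.integral_nonneg h1T (fun t _ => abs_nonneg _)
  have e6 : ∫ t in s₁..s₂, ε ≤ ∫ t in s₁..s₂, f₂ t := by
    apply intervalIntegral.integral_mono_ae_restrict h12 (by simp) i3
    exact ae_restrict_of_ae_restrict_of_subset (Set.Icc_subset_Icc h0 h2T) hlb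
  rw [intervalIntegral.integral_const, smul_eq_mul] at e6
  linarith
end

section
/- Let T > 0, let f₁, f₂ : ℝ → ℝ be integrable on [0, T], and let ε > 0 be such that f₁(t) ≥ ε for almost every t ∈ [0, T]. If 0 ≤ s₁ ≤ s₂ ≤ T and ∫₀^{s₁} f₁(t) dt ≥ ∫₀^{s₂} f₂(t) dt, then ε·(s₂ − s₁) ≤ ∫₀^{T} |f₁(t) − f₂(t)| dt. -/
open Real Set MeasureTheory intervalIntegral

/-- one-sided variant of the quantitative continuity estimate
for the quorum hitting times. -/
theorem stmt_11 (T : ℝ) (hT : 0 < T) (f₁ f₂ : ℝ → ℝ)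
    (hf₁ : IntegrableOn f₁ (Set.Icc 0 T))
    (hf₂ : IntegrableOn f₂ (Set.Icc 0 T))
    (ε : ℝ) (hε : 0 < ε)
    (hlb : ∀ᵐ t ∂(volume.restrict (Set.Icc 0 T)), ε ≤ f₁ t)
    (s₁ s₂ : ℝ) (h0 : 0 ≤ s₁) (h12 : s₁ ≤ s₂) (h2T : s₂ ≤ T)
    (hge : ∫ t in (0:ℝ)..s₁, f₁ t ≥ ∫ t in (0:ℝ)..s₂, f₂ t) :
    ε * (s₂ - s₁) ≤ ∫ t in (0:ℝ)..T, |f₁ t - f₂ t| := by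
  have I : ∀ f : ℝ → ℝ, IntegrableOn f (Set.Icc 0 T) → ∀ a b : ℝ, 0 ≤ a → a ≤ b → b ≤ T →
      IntervalIntegrable f volume a b := by
    intro f hf a b ha hab hb
    rw [intervalIntegrable_iff_integrableOn_Icc_of_le hab]
    exact hf.mono_set (Set.Icc_subset_Icc ha hb)
  have h02 : 0 ≤ s₂ := h0.trans h12
  have habs : IntegrableOn (fun t => |f₁ t - f₂ t|) (Set.Icc 0 T) := (hf₁.sub hf₂).abs
  have e1 : ε * (s₂ - s₁) ≤ ∫ t in s₁..s₂, f₁ t := by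
    have h : ∫ t in s₁..s₂, ε ≤ ∫ t in s₁..s₂, f₁ t := by
      apply intervalIntegral.integral_mono_ae_restrict h12 (by simp) (I f₁ hf₁ _ _ h0 h12 h2T)
      exact ae_restrict_of_ae_restrict_of_subset (Set.Icc_subset_Icc h0 h2T) hlb
    rw [intervalIntegral.integral_const, smul_eq_mul] at h
    linarith
  have e2 := intervalIntegral.integral_add_adjacent_intervals
    (I f₁ hf₁ 0 s₁ le_rfl h0 (h12.trans h2T)) (I f₁ hf₁ _ _ h0 h12 h2T)
  have e3 := intervalIntegral.integral_sub
    (I f₁ hf₁ 0 s₂ le_rfl h02 h2T) (I f₂ hf₂ 0 s₂ le_rfl h02 h2T)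
  have e4 : ∫ t in (0:ℝ)..s₂, (f₁ t - f₂ t) ≤ ∫ t in (0:ℝ)..s₂, |f₁ t - f₂ t| :=
    (le_abs_self _).trans (intervalIntegral.abs_integral_le_integral_abs h02)
  have e5 := intervalIntegral.integral_add_adjacent_intervals
    (I _ habs 0 s₂ le_rfl h02 h2T) (I _ habs s₂ T h02 h2T le_rfl)
  have e6 : 0 ≤ ∫ t in s₂..T, |f₁ t - f₂ t| :=
    intervalIntegral.integral_nonneg h2T (fun t _ => abs_nonneg _)
  linarith
end
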